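/- For the spin-ℓ representation realized on elliptic functions, the identity (θ'₁₁θ₁₀(2y))/(θ₁₀θ₁₁(2y)) + (θ'₁₁θ₀₀(2y))/(θ₀₀θ₁₁(2y)) + (θ'₁₁θ₀₁(2y))/(θ₀₁θ₁₁(2y)) = -(1/2)·℘''(y)/℘'(y) holds, i.e. w₁(2y) + w₂(2y) + w₃(2y) = -(1/2)℘''(y)/℘'(y). -/

import Mathlib

open Complex




/-- Jacobi theta function with characteristics `a, b ∈ {0,1}`. -/
noncomputable def jTheta (a b : ℤ) (u τ : ℂ) : ℂ :=
  ∑' n : ℤ, Complex.exp (Real.pi * Complex.I * ((n : ℂ) + a / 2) ^ 2 * τ +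
    2 * Real.pi * Complex.I * ((n : ℂ) + a / 2) * (u + b / 2))

/-- `θ'₁₁ = (d/du) θ₁₁(u) |_{u=0}`. -/
noncomputable def jTheta11' (τ : ℂ) : ℂ := deriv (fun u => jTheta 1 1 u τ) 0

/-- `w₁(u) = (θ'₁₁/θ₁₀)·θ₁₀(u)/θ₁₁(u)`. -/
noncomputable def w1 (τ u : ℂ) : ℂ :=
  jTheta11' τ / jTheta 1 0 0 τ * (jTheta 1 0 u τ / jTheta 1 1 u τ)

/-- `w₂(u) = (θ'₁₁/θ₀₀)·θ₀₀(u)/θ₁₁(u)`. -/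
noncomputable def w2 (τ u : ℂ) : ℂ :=
  jTheta11' τ / jTheta 0 0 0 τ * (jTheta 0 0 u τ / jTheta 1 1 u τ)

/-- `w₃(u) = (θ'₁₁/θ₀₁)·θ₀₁(u)/θ₁₁(u)`. -/
noncomputable def w3 (τ u : ℂ) : ℂ :=
  jTheta11' τ / jTheta 0 1 0 τ * (jTheta 0 1 u τ / jTheta 1 1 u τ)

/-- The Weierstrass `℘`-function with periods `1` and `τ`. -/
noncomputable def wp (τ u : ℂ) : ℂ :=
  1 / u ^ 2 + ∑' p : ℤ × ℤ, if p = (0, 0) then 0 else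
    (1 / (u - ((p.1 : ℂ) + (p.2 : ℂ) * τ)) ^ 2 - 1 / ((p.1 : ℂ) + (p.2 : ℂ) * τ) ^ 2)


namespace WSum

/-- Entire quotient when the denominator has simple zeros. -/
lemma exists_quot {N D : ℂ → ℂ} (hN : Differentiable ℂ N) (hD : Differentiable ℂ D)
    (hz : ∀ x, D x = 0 → N x = 0 ∧ deriv D x ≠ 0) :
    ∃ E : ℂ → ℂ, Differentiable ℂ E ∧ ∀ x, N x = E x * D x := by
  classical
  refine ⟨fun x => if D x = 0 then deriv N x / deriv D x else N x / D x, ?_, ?_⟩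
  · intro x
    by_cases hx : D x = 0
    · obtain ⟨hNx, hDx⟩ := hz x hx
      have d1 : DifferentiableAt ℂ (dslope N x) x := by
        have := (Complex.differentiableOn_dslope (s := Set.univ) (c := x) (f := N)
          Filter.univ_mem).2 hN.differentiableOn
        exact this.differentiableAt Filter.univ_mem
      have d2 : DifferentiableAt ℂ (dslope D x) x := by
        have := (Complex.differentiableOn_dslope (s := Set.univ) (c := x) (f := D)
          Filter.univ_mem).2 hD.differentiableOn
        exact this.differentiableAt Filter.univ_mem
      have hd0 : dslope D x x ≠ 0 := by rwa [dslope_same]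
      refine (d1.div d2 hd0).congr_of_eventuallyEq ?_
      filter_upwards [d2.continuousAt.eventually_ne hd0] with z hzz
      by_cases hzx : z = x
      · subst hzx; simp [hx]
      · have e1 : D z = (z - x) * dslope D x z := by
          have := sub_smul_dslope D x z
          rw [hx, sub_zero] at this; simpa using this.symm
        have e2 : N z = (z - x) * dslope N x z := by
          have := sub_smul_dslope N x z
          rw [hNx, sub_zero] at this; simpa using this.symm
        have hs : z - x ≠ 0 := sub_ne_zero.2 hzx
        have : D z ≠ 0 := by rw [e1]; exact mul_ne_zero hs hzz
        simp only [this, if_false, Pi.div_apply]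
        rw [e1, e2, mul_div_mul_left _ _ hs]
    · refine ((hN x).div (hD x) hx).congr_of_eventuallyEq ?_
      filter_upwards [(hD x).continuousAt.eventually_ne hx] with z hzz
      simp [hzz]
  · intro x
    by_cases hx : D x = 0
    · simp [hx, (hz x hx).1]
    · simp [hx]

lemma entire_mul_eq_zero {f g : ℂ → ℂ} (hf : Differentiable ℂ f) (hg : Differentiable ℂ g)
    (h : ∀ x, f x * g x = 0) {x₀ : ℂ} (hx : g x₀ ≠ 0) (x : ℂ) : f x = 0 := by
  have hf' : AnalyticOnNhd ℂ f Set.univ := fun x _ => hf.analyticAt x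
  have : f =ᶠ[nhds x₀] 0 := by
    filter_upwards [(hg x₀).continuousAt.eventually_ne hx] with z hz
    exact (mul_eq_zero.1 (h z)).resolve_right hz
  exact hf'.eqOn_zero_of_preconnected_of_eventuallyEq_zero isPreconnected_univ
    (Set.mem_univ x₀) this (Set.mem_univ x)

/-- The lattice. -/
noncomputable def PP (τ : ℂ) (hτ : 0 < τ.im) : PeriodPair where
  ω₁ := 1
  ω₂ := τ
  indep := by
    rw [LinearIndependent.pair_iff]
    intro s t h
    have h2 := congrArg Complex.im h
    have h1 := congrArg Complex.re h
    simp at h1 h2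
    have : t = 0 := by rcases h2 with h2 | h2 <;> [exact h2; exact absurd h2 hτ.ne']
    subst this
    simpa using h1

lemma mem_PP {τ : ℂ} (hτ : 0 < τ.im) {x : ℂ} : x ∈ (PP τ hτ).lattice ↔ ∃ m n : ℤ, (m : ℂ) + n * τ = x := by
  rw [PeriodPair.mem_lattice]; simp [PP]

lemma liouville {τ : ℂ} (hτ : 0 < τ.im) {N D : ℂ → ℂ} (hN : Differentiable ℂ N) (hD : Differentiable ℂ D)
    (hz : ∀ x, D x = 0 → N x = 0 ∧ deriv D x ≠ 0) {x₀ : ℂ} (hx : D x₀ ≠ 0)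
    (h1 : ∀ x, N (x + 1) * D x = N x * D (x + 1))
    (h2 : ∀ x, N (x + τ) * D x = N x * D (x + τ)) : ∃ c : ℂ, ∀ x, N x = c * D x := by
  obtain ⟨E, hE, hNE⟩ := exists_quot hN hD hz
  have key : ∀ ω : ℂ, (∀ x, N (x + ω) * D x = N x * D (x + ω)) → Function.Periodic E ω := by
    intro ω hω x
    have a1 : ∀ x, (E (x + ω) - E x) * D x = 0 := by
      apply entire_mul_eq_zero (g := fun x => D (x + ω)) (x₀ := x₀ - ω) (by fun_prop) (by fun_prop)
      · intro x
        have := hω x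
        rw [hNE, hNE x] at this
        linear_combination this
      · simpa using hx
    exact sub_eq_zero.1 (entire_mul_eq_zero (f := fun x => E (x + ω) - E x) (by fun_prop) hD a1 hx x)
  have p1 := key 1 h1
  have p2 := key τ h2
  refine ⟨E 0, fun x => ?_⟩
  rw [hNE]
  congr 1
  refine hE.apply_eq_apply_of_bounded (IsZLattice.isCompact_range_of_periodic (PP τ hτ).lattice _
    hE.continuous fun z w hw ↦ ?_).isBounded x 0
  obtain ⟨m, n, rfl⟩ := (mem_PP hτ).1 hw
  have q1 := (p1.int_mul m) z
  have q2 := (p2.int_mul n) (z + m)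
  rw [← add_assoc, q2]
  simpa using q1

/-- The product `∏ (1 - q^n x)`. -/
noncomputable def T (q x : ℂ) : ℂ := ∏' n : ℕ, (1 + -(q ^ n * x))

lemma summ {q : ℂ} (hq : ‖q‖ < 1) (x : ℂ) : Summable fun n : ℕ => ‖-(q ^ n * x)‖ := by
  simpa using (summable_geometric_of_lt_one (norm_nonneg _) hq).mul_right ‖x‖

lemma T_succ {q : ℂ} (hq : ‖q‖ < 1) (x : ℂ) : T q x = (1 - x) * T q (q * x) := by
  have e : ∀ n : ℕ, (1 + -(q ^ n * (q * x))) = 1 + -(q ^ (n + 1) * x) := fun n => by ring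
  rw [T, T]
  simp_rw [e]
  rw [tprod_eq_zero_mul']
  · simp [sub_eq_add_neg]
  · simp_rw [← e]
    exact multipliable_one_add_of_summable (summ hq (q * x))

lemma T_zero {q : ℂ} (hq : ‖q‖ < 1) {x : ℂ} (h : T q x = 0) : ∃ n : ℕ, q ^ n * x = 1 := by
  by_contra! hc
  refine tprod_one_add_ne_zero_of_summable (f := fun n : ℕ => -(q ^ n * x)) ?_ (summ hq x) h
  intro n hn
  exact hc n (by linear_combination -hn)

lemma T_diff {q : ℂ} (hq : ‖q‖ < 1) : Differentiable ℂ (T q) := by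
  have H : HasProdLocallyUniformlyOn (fun (n : ℕ) x => 1 + -(q ^ n * x)) (T q) Set.univ := by
    apply hasProdLocallyUniformlyOn_of_forall_compact isOpen_univ
    intro K _ hcK
    obtain ⟨R, hR⟩ := hcK.isBounded.exists_norm_le
    refine ((summable_geometric_of_lt_one (norm_nonneg _) hq).mul_right
      R).hasProdUniformlyOn_nat_one_add hcK (.of_forall fun n x hx ↦ ?_) (fun _ ↦ by fun_prop)
    simpa using mul_le_mul_of_nonneg_left (hR x hx) (by positivity)
  rw [← differentiableOn_univ]
  refine H.differentiableOn (.of_forall fun s ↦ ?_) isOpen_univ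
  have : Differentiable ℂ (fun x => ∏ n ∈ s, (1 + -(q ^ n * x))) :=
    Differentiable.fun_finsetProd (fun _ _ ↦ by fun_prop)
  simpa [Finset.prod_fn] using this.differentiableOn

/-- Product version of `θ₁₁`. -/
noncomputable def S (τ u : ℂ) : ℂ :=
  exp (-(Real.pi * I * u)) * (T (exp (2 * Real.pi * I * τ)) (exp (2 * Real.pi * I * u)) *
    T (exp (2 * Real.pi * I * τ)) (exp (2 * Real.pi * I * (τ - u))))

lemma norm_q {τ : ℂ} (hτ : 0 < τ.im) : ‖exp (2 * Real.pi * I * τ)‖ < 1 := by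
  rw [Complex.norm_exp]
  simp
  positivity

lemma S_diff {τ : ℂ} (hτ : 0 < τ.im) : Differentiable ℂ (S τ) := by
  have := T_diff (norm_q hτ)
  unfold S
  fun_prop

lemma S_add_one {τ : ℂ} (u : ℂ) : S τ (u + 1) = - S τ u := by
  have e1 : exp (-(Real.pi * I * (u + 1))) = - exp (-(Real.pi * I * u)) := by
    rw [show -(Real.pi * I * (u + 1)) = -(Real.pi * I * u) - Real.pi * I by ring,
      exp_sub, exp_pi_mul_I]; ring
  have e2 : exp (2 * Real.pi * I * (u + 1)) = exp (2 * Real.pi * I * u) := by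
    rw [mul_add, mul_one, exp_add, exp_two_pi_mul_I, mul_one]
  have e3 : exp (2 * Real.pi * I * (τ - (u + 1))) = exp (2 * Real.pi * I * (τ - u)) := by
    rw [show 2 * Real.pi * I * (τ - (u + 1)) = 2 * Real.pi * I * (τ - u) - 2 * Real.pi * I by ring,
      exp_sub, exp_two_pi_mul_I, div_one]
  rw [S, S, e1, e2, e3]; ring

lemma S_add_tau {τ : ℂ} (hτ : 0 < τ.im) (u : ℂ) : S τ (u + τ) = - (exp (-(Real.pi * I * τ) - 2 * Real.pi * I * u) * S τ u) := by
  have hq := norm_q hτ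
  have t1 := T_succ hq (exp (2 * Real.pi * I * u))
  have t2 := T_succ hq (exp (-(2 * Real.pi * I * u)))
  rw [← exp_add] at t1 t2
  have e2 : 2 * Real.pi * I * (u + τ) = 2 * Real.pi * I * τ + 2 * Real.pi * I * u := by ring
  have e3 : 2 * Real.pi * I * (τ - (u + τ)) = -(2 * Real.pi * I * u) := by ring
  have e4 : 2 * Real.pi * I * (τ - u) = 2 * Real.pi * I * τ + -(2 * Real.pi * I * u) := by ring
  have e5 : exp (-(Real.pi * I * (u + τ))) = exp (-(Real.pi * I * u)) * exp (-(Real.pi * I * τ)) := by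
    rw [← exp_add]; ring_nf
  have e6 : exp (-(2 * Real.pi * I * u)) * exp (2 * Real.pi * I * u) = 1 := by
    rw [← exp_add]; simp
  have e7 : exp (-(Real.pi * I * τ) - 2 * Real.pi * I * u) =
      exp (-(Real.pi * I * τ)) * exp (-(2 * Real.pi * I * u)) := by
    rw [← exp_add]; ring_nf
  rw [S, S, e2, e3, e4, e5, e7, t2, t1]
  linear_combination (-exp (-(Real.pi * I * u)) * exp (-(Real.pi * I * τ)) *
    T (exp (2 * Real.pi * I * τ)) (exp (2 * Real.pi * I * τ + 2 * Real.pi * I * u)) *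
    T (exp (2 * Real.pi * I * τ)) (exp (2 * Real.pi * I * τ + -(2 * Real.pi * I * u)))) * e6

lemma S_zero {τ : ℂ} (hτ : 0 < τ.im) {u : ℂ} (h : S τ u = 0) : u ∈ (PP τ hτ).lattice := by
  have hq := norm_q hτ
  have hpi : (2 * Real.pi * I : ℂ) ≠ 0 := by simp [Real.pi_ne_zero]
  rw [S, mul_eq_zero, mul_eq_zero] at h
  rw [mem_PP]
  rcases h with h | h | h
  · exact absurd h (exp_ne_zero _)
  · obtain ⟨n, hn⟩ := T_zero hq h
    rw [← exp_nat_mul, ← exp_add, exp_eq_one_iff] at hn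
    obtain ⟨k, hk⟩ := hn
    refine ⟨k, -n, mul_left_cancel₀ hpi ?_⟩
    push_cast
    linear_combination -hk
  · obtain ⟨n, hn⟩ := T_zero hq h
    rw [← exp_nat_mul, ← exp_add, exp_eq_one_iff] at hn
    obtain ⟨k, hk⟩ := hn
    refine ⟨-k, n + 1, mul_left_cancel₀ hpi ?_⟩
    push_cast
    linear_combination hk

lemma T_q_ne {τ : ℂ} (hτ : 0 < τ.im) : T (exp (2 * Real.pi * I * τ)) (exp (2 * Real.pi * I * τ)) ≠ 0 := by
  intro h
  obtain ⟨n, hn⟩ := T_zero (norm_q hτ) h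
  have := congrArg norm hn
  rw [← pow_succ, norm_pow, norm_one] at this
  exact absurd this (pow_lt_one₀ (norm_nonneg _) (norm_q hτ) (by simp)).ne

lemma S_deriv_zero {τ : ℂ} (hτ : 0 < τ.im) : deriv (S τ) 0 ≠ 0 := by
  have hT := T_diff (norm_q hτ)
  set q := exp (2 * Real.pi * I * τ) with hqd
  have e : S τ = fun u => (1 - exp (2 * Real.pi * I * u)) * (exp (-(Real.pi * I * u)) *
      (T q (q * exp (2 * Real.pi * I * u)) * T q (exp (2 * Real.pi * I * (τ - u))))) := by
    ext u
    rw [S, ← hqd, T_succ (norm_q hτ) (exp (2 * Real.pi * I * u))]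
    ring
  set g : ℂ → ℂ := fun u => (exp (-(Real.pi * I * u)) *
      (T q (q * exp (2 * Real.pi * I * u)) * T q (exp (2 * Real.pi * I * (τ - u))))) with hg
  have hgd : DifferentiableAt ℂ g 0 := by
    rw [hg]; fun_prop
  have h1 : HasDerivAt (fun u : ℂ => 1 - exp (2 * Real.pi * I * u)) (-(2 * Real.pi * I)) 0 := by
    have := (((hasDerivAt_id (0:ℂ)).const_mul (2 * Real.pi * I)).cexp).const_sub 1
    simpa using this
  have h2 := h1.mul hgd.hasDerivAt
  have h3 : deriv (S τ) 0 = -(2 * Real.pi * I) * g 0 := by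
    rw [e]
    refine (h2.deriv).trans ?_
    simp
  rw [h3]
  have : g 0 = T q q * T q q := by simp [hg, ← hqd]
  rw [this]
  have := T_q_ne hτ
  simp [Real.pi_ne_zero]
  exact this


lemma jT_eq (a b : ℤ) (u τ : ℂ) : jTheta a b u τ =
    exp (Real.pi * I * (a / 2) ^ 2 * τ + Real.pi * I * a * (u + b / 2)) *
      jacobiTheta₂ (u + b / 2 + a * τ / 2) τ := by
  rw [jTheta, jacobiTheta₂, ← tsum_mul_left]
  refine tsum_congr fun n => ?_
  rw [jacobiTheta₂_term, ← exp_add]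
  ring_nf

lemma jT_diff {τ : ℂ} (hτ : 0 < τ.im) (a b : ℤ) : Differentiable ℂ (fun u => jTheta a b u τ) := by
  have h : Differentiable ℂ (fun u => jacobiTheta₂ u τ) :=
    fun u => differentiableAt_jacobiTheta₂_fst u hτ
  simp_rw [jT_eq]
  have h2 : Differentiable ℂ (fun u : ℂ => jacobiTheta₂ (u + b / 2 + a * τ / 2) τ) :=
    h.comp (by fun_prop : Differentiable ℂ (fun u : ℂ => u + b / 2 + a * τ / 2))
  fun_prop

lemma jT_add_one (a b : ℤ) (u τ : ℂ) :
    jTheta a b (u + 1) τ = exp (Real.pi * I * a) * jTheta a b u τ := by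
  rw [jT_eq, jT_eq, show u + 1 + b / 2 + a * τ / 2 = u + b / 2 + a * τ / 2 + 1 by ring,
    jacobiTheta₂_add_left, ← mul_assoc, ← exp_add]
  ring_nf

lemma jT_add_tau (a b : ℤ) (u τ : ℂ) :
    jTheta a b (u + τ) τ = exp (-(Real.pi * I * b)) *
      (exp (-(Real.pi * I * τ) - 2 * Real.pi * I * u) * jTheta a b u τ) := by
  rw [jT_eq, jT_eq, show u + τ + b / 2 + a * τ / 2 = u + b / 2 + a * τ / 2 + τ by ring,
    jacobiTheta₂_add_left', ← mul_assoc, ← mul_assoc, ← mul_assoc, ← exp_add, ← exp_add, ← exp_add]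
  ring_nf

/-- multiplier -/
noncomputable def ee (τ u : ℂ) : ℂ := exp (-(Real.pi * I * τ) - 2 * Real.pi * I * u)

lemma ee_ne (τ u : ℂ) : ee τ u ≠ 0 := exp_ne_zero _

lemma exp_neg_pi : exp (-(Real.pi * I)) = -1 := by
  rw [exp_neg, exp_pi_mul_I]; norm_num

lemma j11_one (u τ : ℂ) : jTheta 1 1 (u + 1) τ = -jTheta 1 1 u τ := by
  rw [jT_add_one]; simp [exp_pi_mul_I]
lemma j10_one (u τ : ℂ) : jTheta 1 0 (u + 1) τ = -jTheta 1 0 u τ := by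
  rw [jT_add_one]; simp [exp_pi_mul_I]
lemma j00_one (u τ : ℂ) : jTheta 0 0 (u + 1) τ = jTheta 0 0 u τ := by
  rw [jT_add_one]; simp
lemma j01_one (u τ : ℂ) : jTheta 0 1 (u + 1) τ = jTheta 0 1 u τ := by
  rw [jT_add_one]; simp
lemma j11_tau (u τ : ℂ) : jTheta 1 1 (u + τ) τ = -(ee τ u * jTheta 1 1 u τ) := by
  rw [jT_add_tau, ← ee]; simp [exp_neg_pi]
lemma j01_tau (u τ : ℂ) : jTheta 0 1 (u + τ) τ = -(ee τ u * jTheta 0 1 u τ) := by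
  rw [jT_add_tau, ← ee]; simp [exp_neg_pi]
lemma j10_tau (u τ : ℂ) : jTheta 1 0 (u + τ) τ = ee τ u * jTheta 1 0 u τ := by
  rw [jT_add_tau, ← ee]; simp
lemma j00_tau (u τ : ℂ) : jTheta 0 0 (u + τ) τ = ee τ u * jTheta 0 0 u τ := by
  rw [jT_add_tau, ← ee]; simp

lemma j00_neg (u τ : ℂ) : jTheta 0 0 (-u) τ = jTheta 0 0 u τ := by
  simp [jT_eq, jacobiTheta₂_neg_left]
lemma j01_neg (u τ : ℂ) : jTheta 0 1 (-u) τ = jTheta 0 1 u τ := by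
  simp only [jT_eq]
  rw [← jacobiTheta₂_neg_left, ← jacobiTheta₂_add_left]
  simp; ring_nf
lemma j10_neg (u τ : ℂ) : jTheta 1 0 (-u) τ = jTheta 1 0 u τ := by
  simp only [jT_eq]
  rw [← jacobiTheta₂_neg_left, show -(-u + ((0:ℤ):ℂ) / 2 + ((1 : ℤ):ℂ) * τ / 2) = u - τ / 2 by
    push_cast; ring, show u + ((0:ℤ):ℂ) / 2 + ((1 : ℤ):ℂ) * τ / 2 = (u - τ / 2) + τ by
    push_cast; ring, jacobiTheta₂_add_left', ← mul_assoc, ← exp_add]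
  push_cast; ring_nf
lemma j11_neg (u τ : ℂ) : jTheta 1 1 (-u) τ = -jTheta 1 1 u τ := by
  have e : ∀ v, jTheta 1 1 v τ = jTheta 1 0 (v + 1 / 2) τ := by
    intro v; simp [jT_eq]
  rw [e, e, ← j10_neg, ← neg_eq_iff_eq_neg, ← j10_one]
  ring_nf

lemma ne_zero_of_j11 {a b : ℤ} (a' b' : ℂ) (u τ : ℂ) (ha : (a : ℂ) = 1 - a') (hb : (b : ℂ) = 1 - b')
    (h : jTheta a b u τ = 0) : jTheta 1 1 (u - b' / 2 - a' * τ / 2) τ = 0 := by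
  rw [jT_eq] at h ⊢
  have := (mul_eq_zero.1 h).resolve_left (exp_ne_zero _)
  rw [ha, hb] at this
  rw [mul_eq_zero]; right
  rw [← this]
  push_cast; ring_nf

variable {τ : ℂ} (hτ : 0 < τ.im)

/-- Translation-invariant sets of zeros. -/
lemma lat_induct {f : ℂ → ℂ} (h1 : ∀ x, f (x + 1) = 0 ↔ f x = 0) (h2 : ∀ x, f (x + τ) = 0 ↔ f x = 0)
    {l : ℂ} (hl : l ∈ (PP τ hτ).lattice) (x : ℂ) : f (x + l) = 0 ↔ f x = 0 := by
  obtain ⟨m, n, rfl⟩ := (mem_PP hτ).1 hl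
  have key : ∀ (ω : ℂ) (_ : ∀ x, f (x + ω) = 0 ↔ f x = 0) (k : ℤ) (x : ℂ),
      f (x + k * ω) = 0 ↔ f x = 0 := by
    intro ω hω k x
    have hp : Function.Periodic (fun x => f x = 0) ω := fun x => propext (hω x)
    exact iff_of_eq ((hp.int_mul k) x)
  rw [← add_assoc, key τ h2 n]
  simpa using key 1 h1 m x

/-- derivative of quasi-periodicity -/
lemma deriv_shift {f m : ℂ → ℂ} {ω : ℂ} (hf : Differentiable ℂ f) (hm : Differentiable ℂ m)
    (h : ∀ x, f (x + ω) = m x * f x) (x : ℂ) :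
    deriv f (x + ω) = deriv m x * f x + m x * deriv f x := by
  rw [← deriv_comp_add_const, show (fun x => f (x + ω)) = fun x => m x * f x from funext h]
  exact deriv_fun_mul (hm x) (hf x)

lemma ee_diff (τ : ℂ) : Differentiable ℂ (ee τ) := by
  unfold ee; fun_prop

lemma ee_deriv (τ u : ℂ) : deriv (ee τ) u = -(2 * Real.pi * I) * ee τ u := by
  have : HasDerivAt (ee τ) (exp (-(Real.pi * I * τ) - 2 * Real.pi * I * u) *
      (-((2 * Real.pi * I) * 1))) u :=
    (((hasDerivAt_id u).const_mul (2 * Real.pi * I)).const_sub _).cexp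
  rw [this.deriv, ee]; ring

lemma simple_lattice {f : ℂ → ℂ} (hf : Differentiable ℂ f) (h1 : ∀ u, f (u + 1) = -f u)
    (h2 : ∀ u, f (u + τ) = -(ee τ u * f u)) (h0 : f 0 = 0) (hd : deriv f 0 ≠ 0)
    {l : ℂ} (hl : l ∈ (PP τ hτ).lattice) : f l = 0 ∧ deriv f l ≠ 0 := by
  have A : ∀ x, f x = 0 ↔ f (x + l) = 0 := fun x => (lat_induct hτ (f := f)
    (fun x => by simp [h1]) (fun x => by simp [h2, ee_ne]) hl x).symm
  have hl0 : f l = 0 := by have := (A 0).1 h0; simpa using this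
  refine ⟨hl0, ?_⟩
  -- use the indicator of a double zero
  classical
  let g : ℂ → ℂ := fun x => if f x = 0 ∧ deriv f x = 0 then 0 else 1
  have hg : ∀ x, g x = 0 ↔ f x = 0 ∧ deriv f x = 0 := fun x => by simp [g]
  have d1 : ∀ x, deriv f (x + 1) = -deriv f x := fun x => by
    have := deriv_shift (m := fun _ => -1) (ω := 1) hf (by fun_prop) (fun x => by rw [h1]; ring) x
    rw [this]; simp
  have d2 : ∀ x, deriv f (x + τ) = 2 * Real.pi * I * ee τ x * f x - ee τ x * deriv f x := fun x => by
    have := deriv_shift (m := fun x => -ee τ x) (ω := τ) hf (ee_diff τ).neg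
      (fun x => by rw [h2]; ring) x
    rw [this, deriv.fun_neg, ee_deriv]; ring
  have B := lat_induct hτ (f := g) (fun x => by simp [hg, h1, d1]) (fun x => by
    rw [hg, hg, h2, d2]
    constructor
    · rintro ⟨a, b⟩
      have : f x = 0 := by simpa [ee_ne] using a
      exact ⟨this, by simpa [this, ee_ne] using b⟩
    · rintro ⟨a, b⟩; simp [a, b]) hl 0
  intro hc
  rw [zero_add, hg, hg] at B
  exact hd (B.1 ⟨hl0, hc⟩).2

/-- Everything about the zeros of `θ₁₁`. -/
lemma theta_zeros {y₀ : ℂ} (hy : jTheta 1 1 y₀ τ ≠ 0) :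
    (∀ u, jTheta 1 1 u τ = 0 ↔ u ∈ (PP τ hτ).lattice) ∧
    (∀ u, jTheta 1 1 u τ = 0 → deriv (fun u => jTheta 1 1 u τ) u ≠ 0) := by
  have S0 : S τ 0 = 0 := by
    rw [S, T_succ (norm_q hτ) (exp (2 * Real.pi * I * 0))]; simp
  have SL := fun l hl => simple_lattice (l := l) hτ (S_diff hτ) S_add_one
    (fun u => S_add_tau hτ u) S0 (S_deriv_zero hτ) hl
  have t0 : jTheta 1 1 0 τ = 0 := by
    have := j11_neg 0 τ
    rw [neg_zero] at this
    exact self_eq_neg.1 this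
  have tL : ∀ l ∈ (PP τ hτ).lattice, jTheta 1 1 l τ = 0 := by
    intro l hl
    have := (lat_induct hτ (f := fun u => jTheta 1 1 u τ) (fun x => by simp [j11_one])
      (fun x => by simp [j11_tau, ee_ne]) hl 0).2 t0
    simpa using this
  have hSne : ∃ x, S τ x ≠ 0 := by
    by_contra! hc
    have : S τ = fun _ => 0 := funext hc
    apply S_deriv_zero hτ
    rw [this]; simp
  obtain ⟨x₀, hx₀⟩ := hSne
  obtain ⟨c, hc⟩ := liouville hτ (jT_diff hτ 1 1) (S_diff hτ)
    (fun x hx => ⟨tL x (S_zero hτ hx), (SL x (S_zero hτ hx)).2⟩) hx₀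
    (fun x => by simp only [j11_one, S_add_one]; ring)
    (fun x => by simp only [j11_tau, S_add_tau hτ, ee]; ring)
  have hc0 : c ≠ 0 := by
    rintro rfl
    exact hy (by simpa using hc y₀)
  have hfun : (fun u => jTheta 1 1 u τ) = fun u => c * S τ u := funext hc
  have hz : ∀ u, jTheta 1 1 u τ = 0 ↔ u ∈ (PP τ hτ).lattice := fun u =>
    ⟨fun h => S_zero hτ ((mul_eq_zero.1 ((hc u).symm.trans h)).resolve_left hc0), tL u⟩
  refine ⟨hz, fun u hu => ?_⟩
  rw [hfun, deriv_const_mul _ (S_diff hτ u)]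
  exact mul_ne_zero hc0 (SL u ((hz u).1 hu)).2


lemma wp_eq : wp τ = (PP τ hτ).weierstrassP := by
  funext u
  have h := (PP τ hτ).hasSum_weierstrassP u
  rw [← (PP τ hτ).latticeEquivProd.symm.toEquiv.hasSum_iff] at h
  have h2 := h.tsum_eq
  rw [h.summable.tsum_eq_add_tsum_ite (0, 0)] at h2
  rw [← h2, wp]
  congr 1
  · rw [show ((0 : ℤ), (0 : ℤ)) = 0 from rfl]; simp
  · refine tsum_congr fun p => ?_
    by_cases hp : p = (0, 0)
    · simp [hp]
    · simp only [hp, if_false, Function.comp]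
      have := (PP τ hτ).latticeEquiv_symm_apply p
      simp only [PP, mul_one] at this
      rw [← this]
      rfl

lemma half_mem {a b : ℤ} (h : ((a : ℂ) + b * τ) / 2 ∈ (PP τ hτ).lattice) :
    ∃ m n : ℤ, a = 2 * m ∧ b = 2 * n := by
  obtain ⟨m, n, hmn⟩ := (mem_PP hτ).1 h
  have h0 : ((2 * m - a : ℤ) : ℂ) + ((2 * n - b : ℤ) : ℂ) * τ = 0 := by
    push_cast; linear_combination 2 * hmn
  have h2 := congrArg Complex.im h0
  have hb : (2 * n - b : ℤ) = 0 := by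
    have : ((2 * n - b : ℤ) : ℝ) * τ.im = 0 := by
      simpa using h2
    exact_mod_cast (mul_eq_zero.1 this).resolve_right hτ.ne'
  rw [hb] at h0
  have ha : (2 * m - a : ℤ) = 0 := by
    have : ((2 * m - a : ℤ) : ℂ) = 0 := by simpa using h0
    exact_mod_cast this
  exact ⟨m, n, by omega, by omega⟩

lemma notMem_half {a b : ℤ} (h : a % 2 = 1 ∨ b % 2 = 1) :
    ((a : ℂ) + b * τ) / 2 ∉ (PP τ hτ).lattice := by
  intro hm
  obtain ⟨m, n, h1, h2⟩ := half_mem hτ hm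
  omega

/-- `℘' θ₁₁⁴` is entire -/
lemma N_diff {f : ℂ → ℂ} (hf : Differentiable ℂ f) (h0 : ∀ l ∈ (PP τ hτ).lattice, f l = 0) :
    Differentiable ℂ (fun u => (PP τ hτ).derivWeierstrassP u * f u ^ 4) := by
  intro x
  set L := PP τ hτ
  by_cases hx : x ∈ L.lattice
  · have d1 : DifferentiableAt ℂ (dslope f x) x := by
      have := (Complex.differentiableOn_dslope (s := Set.univ) (c := x) (f := f)
        Filter.univ_mem).2 hf.differentiableOn
      exact this.differentiableAt Filter.univ_mem
    have d2 : DifferentiableAt ℂ (L.derivWeierstrassPExcept x) x :=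
      (L.analyticAt_derivWeierstrassPExcept x).differentiableAt
    have hfx := hf x
    have : DifferentiableAt ℂ (fun z => L.derivWeierstrassPExcept x z * f z ^ 4 -
      2 * f z * dslope f x z ^ 3) x := by fun_prop
    refine this.congr_of_eventuallyEq (Filter.Eventually.of_forall fun z => ?_)
    have e := L.derivWeierstrassPExcept_sub ⟨x, hx⟩ z
    simp only at e
    simp only [← e]
    by_cases hz : z = x
    · subst hz; simp [h0 z hx]
    · have e1 : f z = (z - x) * dslope f x z := by
        have := sub_smul_dslope f x z
        rw [h0 x hx, sub_zero] at this; simpa using this.symm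
      have hs : z - x ≠ 0 := sub_ne_zero.2 hz
      have e2 : 2 / (z - x) ^ 3 * f z ^ 4 = 2 * f z * dslope f x z ^ 3 := by
        rw [show f z ^ 4 = f z ^ 3 * f z by ring]
        nth_rw 1 [e1]
        field_simp
      rw [sub_mul, e2]
  · have d2 : DifferentiableAt ℂ L.derivWeierstrassP x :=
      (L.analyticOnNhd_derivWeierstrassP x hx).differentiableAt
    have hfx := hf x
    fun_prop

lemma main {τ : ℂ} (hτ : 0 < τ.im) (y : ℂ) (hy : jTheta 1 1 (2 * y) τ ≠ 0) (hy' : deriv (wp τ) y ≠ 0) :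
    w1 τ (2 * y) + w2 τ (2 * y) + w3 τ (2 * y) =
      - (1 / 2) * (deriv (deriv (wp τ)) y / deriv (wp τ) y) := by
  obtain ⟨hz, hs⟩ := theta_zeros hτ hy
  set L := PP τ hτ with hL
  have g10 : jTheta 1 0 0 τ ≠ 0 := fun h => by
    have := (hz _).1 (ne_zero_of_j11 0 1 0 τ (by simp) (by simp) h)
    refine notMem_half hτ (a := -1) (b := 0) (by simp) ?_
    convert this using 1; push_cast; ring
  have g00 : jTheta 0 0 0 τ ≠ 0 := fun h => by
    have := (hz _).1 (ne_zero_of_j11 1 1 0 τ (by simp) (by simp) h)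
    refine notMem_half hτ (a := -1) (b := -1) (by simp) ?_
    convert this using 1; push_cast; ring
  have g01 : jTheta 0 1 0 τ ≠ 0 := fun h => by
    have := (hz _).1 (ne_zero_of_j11 1 0 0 τ (by simp) (by simp) h)
    refine notMem_half hτ (a := 0) (b := -1) (by simp) ?_
    convert this using 1; push_cast; ring
  have k10 := jT_diff hτ 1 0
  have k00 := jT_diff hτ 0 0
  have k01 := jT_diff hτ 0 1
  have kf := jT_diff hτ 1 1
  set f : ℂ → ℂ := fun u => jTheta 1 1 u τ with hf
  have ft : ∀ u, jTheta 1 1 u τ = f u := fun u => rfl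
  simp only [ft] at hz hs hy
  have f1 : ∀ u, f (u + 1) = -f u := fun u => j11_one u τ
  have f2 : ∀ u, f (u + τ) = -(ee τ u * f u) := fun u => j11_tau u τ
  have fn : ∀ u, f (-u) = -f u := fun u => j11_neg u τ
  have f0 : f 0 = 0 := (hz 0).2 (zero_mem _)
  have kd : Differentiable ℂ (deriv f) := fun x => (kf.analyticAt x).deriv.differentiableAt
  have d1 : ∀ x, deriv f (x + 1) = -deriv f x := fun x => by
    have := deriv_shift (m := fun _ => -1) (ω := 1) kf (by fun_prop) (fun x => by rw [f1]; ring) x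
    rw [this]; simp
  have d2 : ∀ x, deriv f (x + τ) = 2 * Real.pi * I * ee τ x * f x - ee τ x * deriv f x := fun x => by
    have := deriv_shift (m := fun x => -ee τ x) (ω := τ) kf (ee_diff τ).neg
      (fun x => by rw [f2]; ring) x
    rw [this, deriv.fun_neg, ee_deriv]; ring
  have dn : ∀ x, deriv f (-x) = deriv f x := fun x => by
    have h1 : deriv (fun x => f (-x)) x = -deriv f (-x) := deriv_comp_neg f x
    rw [funext fn, deriv.fun_neg] at h1
    exact (neg_injective h1).symm
  -- doubled function
  have k2 : Differentiable ℂ (fun u => f (2 * u)) := by fun_prop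
  have e2 : ∀ x, deriv (fun u => f (2 * u)) x = 2 * deriv f (2 * x) := fun x => by
    have h1 : HasDerivAt (fun u : ℂ => 2 * u) 2 x := by
      simpa using (hasDerivAt_id x).const_mul (2 : ℂ)
    have h2 : HasDerivAt (fun u => f (2 * u)) (deriv f (2 * x) * 2) x :=
      HasDerivAt.comp x (kf (2 * x)).hasDerivAt h1
    rw [h2.deriv, mul_comm]
  have s2 : ∀ x, f (2 * x) = 0 → deriv (fun u => f (2 * u)) x ≠ 0 := fun x hx => by
    rw [e2]; exact mul_ne_zero two_ne_zero (hs _ hx)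
  have a1 : ∀ x, f (2 * (x + 1)) = f (2 * x) := fun x => by
    rw [show 2 * (x + 1) = 2 * x + 1 + 1 by ring, f1, f1, neg_neg]
  have a2 : ∀ x, f (2 * (x + τ)) = ee τ (2 * x + τ) * ee τ (2 * x) * f (2 * x) := fun x => by
    rw [show 2 * (x + τ) = 2 * x + τ + τ by ring, f2, f2]; ring
  have ee_add : ∀ x, ee τ x ^ 4 = ee τ (2 * x + τ) * ee τ (2 * x) := fun x => by
    simp only [ee]
    rw [← exp_nat_mul, ← exp_add]
    congr 1; push_cast; ring
  -- step 1: `℘' θ⁴ = C θ(2·)`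
  have hwp : wp τ = L.weierstrassP := wp_eq hτ
  have hP : deriv (wp τ) = L.derivWeierstrassP := by rw [hwp, L.deriv_weierstrassP]
  have one_mem : (1 : ℂ) ∈ L.lattice := L.ω₁_mem_lattice
  have tau_mem : τ ∈ L.lattice := L.ω₂_mem_lattice
  obtain ⟨C, hC⟩ := liouville hτ (N_diff hτ kf (fun l hl => (hz l).2 hl)) k2
    (fun x hx => ⟨by
      have hx2 := (hz _).1 hx
      by_cases hxL : x ∈ L.lattice
      · simp [(hz x).2 hxL]
      · have h3 := L.derivWeierstrassP_sub_coe x ⟨_, hx2⟩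
        have h4 := L.derivWeierstrassP_neg x
        simp only at h3
        rw [show x - 2 * x = -x by ring, h4] at h3
        have : L.derivWeierstrassP x = 0 := self_eq_neg.1 h3.symm
        rw [← hL, this, zero_mul], s2 x hx⟩) hy
    (fun x => by
      have h3 := L.derivWeierstrassP_add_coe x ⟨_, one_mem⟩
      simp only at h3
      rw [← hL, h3, f1, a1]; ring)
    (fun x => by
      have h3 := L.derivWeierstrassP_add_coe x ⟨_, tau_mem⟩
      simp only at h3
      rw [← hL, h3, f2, a2, ← ee_add]; ring)
  rw [← hL] at hC
  -- step 2: `θ(2u) = M(u) θ(u)`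
  have dbl : ∀ x, x ∈ L.lattice → 2 * x ∈ L.lattice := fun x hx => by
    rw [two_mul]; exact add_mem hx hx
  obtain ⟨M, kM, hM⟩ := exists_quot k2 kf (fun x hx => ⟨(hz _).2 (dbl x ((hz x).1 hx)), hs x hx⟩)
  have M1 : ∀ x, M (x + 1) = -M x := fun x => by
    have := entire_mul_eq_zero (f := fun x => M (x + 1) + M x) (by fun_prop) kf (fun x => by
      have h1 := hM (x + 1)
      rw [a1, hM x, f1] at h1
      linear_combination h1) hy x
    exact eq_neg_of_add_eq_zero_left this
  have M2 : ∀ x, ee τ x * M (x + τ) = -(ee τ (2 * x + τ) * ee τ (2 * x) * M x) := fun x => by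
    have ked := ee_diff τ
    have := entire_mul_eq_zero (f := fun x => ee τ x * M (x + τ) +
      ee τ (2 * x + τ) * ee τ (2 * x) * M x) (by fun_prop) kf (fun x => by
      have h1 := hM (x + τ)
      rw [a2, hM x, f2] at h1
      linear_combination h1) hy x
    exact eq_neg_of_add_eq_zero_left this
  have Mn : ∀ x, M (-x) = M x := fun x => by
    have := entire_mul_eq_zero (f := fun x => M (-x) - M x) (by fun_prop) kf (fun x => by
      have h1 := hM (-x)
      rw [show 2 * -x = -(2 * x) by ring, fn, fn, hM x] at h1
      linear_combination h1) hy x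
    exact sub_eq_zero.1 this
  -- step 3
  set p := deriv f 0 / jTheta 1 0 0 τ with hp
  set q := deriv f 0 / jTheta 0 0 0 τ with hq
  set r := deriv f 0 / jTheta 0 1 0 τ with hr
  have hp' : p * jTheta 1 0 0 τ = deriv f 0 := div_mul_cancel₀ _ g10
  have hq' : q * jTheta 0 0 0 τ = deriv f 0 := div_mul_cancel₀ _ g00
  have hr' : r * jTheta 0 1 0 τ = deriv f 0 := div_mul_cancel₀ _ g01
  set K : ℂ → ℂ := fun u => p * jTheta 1 0 u τ + q * jTheta 0 0 u τ + r * jTheta 0 1 u τ with hK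
  have kK : Differentiable ℂ K := by rw [hK]; fun_prop
  have K1 : ∀ x, K (2 * (x + 1)) = K (2 * x) := fun x => by
    simp only [hK]
    rw [show 2 * (x + 1) = 2 * x + 1 + 1 by ring]
    simp only [j10_one, j00_one, j01_one]; ring
  have K2 : ∀ x, K (2 * (x + τ)) = ee τ (2 * x + τ) * ee τ (2 * x) * K (2 * x) := fun x => by
    simp only [hK]
    rw [show 2 * (x + τ) = 2 * x + τ + τ by ring]
    simp only [j10_tau, j00_tau, j01_tau]; ring
  have Kn : ∀ x, K (-x) = K x := fun x => by
    simp only [hK, j10_neg, j00_neg, j01_neg]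
  set N : ℂ → ℂ := fun u => K (2 * u) + deriv f (2 * u) - 2 * deriv f u * M u with hN
  have kN : Differentiable ℂ N := by rw [hN]; fun_prop
  have N1 : ∀ x, N (x + 1) = N x := fun x => by
    simp only [hN]
    rw [K1, d1, M1, show 2 * (x + 1) = 2 * x + 1 + 1 by ring, d1, d1]; ring
  have N2 : ∀ x, N (x + τ) = ee τ (2 * x + τ) * ee τ (2 * x) * N x := fun x => by
    simp only [hN]
    have h1 := hM x
    have h2 := M2 x
    rw [K2, d2, show 2 * (x + τ) = 2 * x + τ + τ by ring, d2, d2, f2]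
    linear_combination (2 * deriv f x - 4 * Real.pi * I * f x) * h2 -
      (4 * Real.pi * I * ee τ (2 * x + τ) * ee τ (2 * x)) * h1
  have Nn : ∀ x, N (-x) = N x := fun x => by
    simp only [hN]
    rw [show 2 * -x = -(2 * x) by ring, Kn, dn, dn, Mn]
  have Nz : ∀ x, f (2 * x) = 0 → N x = 0 := by
    have Minv := fun {l : ℂ} (hl : l ∈ L.lattice) (x : ℂ) => lat_induct hτ (f := N)
      (fun x => by rw [N1]) (fun x => by simp [N2, ee_ne]) hl x
    have v0 : N 0 = 0 := by
      have hM0 : M 0 = 2 := by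
        have h1 := e2 0
        rw [funext hM] at h1
        rw [deriv_fun_mul (kM 0) (kf 0), f0, mul_zero, mul_zero, zero_add] at h1
        exact mul_right_cancel₀ (hs 0 f0) h1
      simp only [hN, hK, mul_zero, hM0, hp', hq', hr']
      ring
    have vM : ∀ x, f (2 * x) = 0 → x ∉ L.lattice → M x = 0 := fun x hx hxl => by
      rw [hM] at hx
      exact (mul_eq_zero.1 hx).resolve_right (fun h => hxl ((hz x).1 h))
    have v1 : N (1 / 2) = 0 := by
      have h2 : (2 * (1 / 2) : ℂ) = 0 + 1 := by norm_num
      have hm := vM (1 / 2) (by rw [h2, f1, f0, neg_zero]) (by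
        have := notMem_half hτ (a := 1) (b := 0) (by simp)
        simpa using this)
      simp only [hN, hK, hm, h2, j10_one, j00_one, j01_one, d1]
      linear_combination -hp' + hq' + hr'
    have v2 : N (τ / 2) = 0 := by
      have h2 : (2 * (τ / 2) : ℂ) = 0 + τ := by ring
      have hm := vM (τ / 2) (by rw [h2, f2, f0]; simp) (by
        have := notMem_half hτ (a := 0) (b := 1) (by simp)
        simpa using this)
      simp only [hN, hK, hm, h2, j10_tau, j00_tau, j01_tau, d2, f0]
      linear_combination ee τ 0 * (hp' + hq' - hr')
    have v3 : N ((1 + τ) / 2) = 0 := by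
      have h2 : (2 * ((1 + τ) / 2) : ℂ) = 0 + τ + 1 := by ring
      have hm := vM ((1 + τ) / 2) (by rw [h2, f1, f2, f0]; simp) (by
        have := notMem_half hτ (a := 1) (b := 1) (by simp)
        simpa using this)
      simp only [hN, hK, hm, h2, j10_one, j00_one, j01_one, d1, j10_tau, j00_tau, j01_tau, d2, f0]
      linear_combination ee τ 0 * (-hp' + hq' - hr')
    intro x hx
    obtain ⟨m, n, hmn⟩ := (mem_PP hτ).1 ((hz _).1 hx)
    have cast : ∀ (m' n' : ℤ) (x₀ : ℂ), x = x₀ + (m' + n' * τ) → N x₀ = 0 → N x = 0 := by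
      intro m' n' x₀ hxe h0
      rw [hxe]
      exact (Minv ((mem_PP hτ).2 ⟨m', n', rfl⟩) x₀).2 h0
    rcases Int.even_or_odd' m with ⟨m', rfl | rfl⟩ <;> rcases Int.even_or_odd' n with ⟨n', rfl | rfl⟩
    · exact cast m' n' 0 (by push_cast at hmn; linear_combination -hmn / 2) v0
    · exact cast m' n' (τ / 2) (by push_cast at hmn; linear_combination -hmn / 2) v2
    · exact cast m' n' (1 / 2) (by push_cast at hmn; linear_combination -hmn / 2) v1
    · exact cast m' n' ((1 + τ) / 2) (by push_cast at hmn; linear_combination -hmn / 2) v3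
  obtain ⟨c, hc⟩ := liouville hτ kN k2 (fun x hx => ⟨Nz x hx, s2 x hx⟩) hy
    (fun x => by rw [N1, a1]) (fun x => by rw [N2, a2]; ring)
  have Ny : N y = 0 := by
    have h1 := hc (-y)
    rw [Nn, hc y, show 2 * -y = -(2 * y) by ring, fn, mul_neg] at h1
    rw [hc y]; exact self_eq_neg.1 h1
  -- conclusion
  have yL : y ∉ L.lattice := fun h => hy ((hz _).2 (dbl y h))
  have fy : f y ≠ 0 := fun h => yL ((hz y).1 h)
  have dP : DifferentiableAt ℂ L.derivWeierstrassP y :=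
    (L.analyticOnNhd_derivWeierstrassP y yL).differentiableAt
  rw [hP] at hy' ⊢
  have D1 : deriv L.derivWeierstrassP y * f y ^ 4 + L.derivWeierstrassP y * (4 * f y ^ 3 * deriv f y)
      = C * (2 * deriv f (2 * y)) := by
    rw [← e2, ← deriv_const_mul _ (k2 y), ← funext hC]
    have h4 := (kf y).hasDerivAt.pow 4
    have h5 := (dP.hasDerivAt.mul h4).deriv
    refine Eq.trans ?_ h5.symm
    simp
  have W : w1 τ (2 * y) + w2 τ (2 * y) + w3 τ (2 * y) = K (2 * y) / f (2 * y) := by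
    simp only [w1, w2, w3, jTheta11', hK, ← hf, ft, ← hp, ← hq, ← hr]
    ring
  rw [W]
  have hCy := hC y
  have hMy := hM y
  have hNy : K (2 * y) + deriv f (2 * y) - 2 * deriv f y * M y = 0 := Ny
  generalize L.derivWeierstrassP y = P at *
  generalize deriv L.derivWeierstrassP y = P' at *
  generalize K (2 * y) = k at *
  generalize f (2 * y) = F at *
  generalize deriv f (2 * y) = F' at *
  generalize deriv f y = g' at *
  generalize f y = g at *
  generalize M y = m at *
  have hk : k = 2 * g' * m - F' := by linear_combination hNy
  have hP' : P' * g ^ 4 * F = 2 * F' * P * g ^ 4 - 4 * P * g ^ 3 * g' * F := by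
    linear_combination F * D1 - 2 * F' * hCy
  rw [← mul_div_assoc, div_eq_div_iff hy hy']
  apply mul_right_cancel₀ (pow_ne_zero 4 fy)
  rw [hk]
  linear_combination (1 / 2) * hP' + (-2) * g' * g ^ 3 * P * hMy

end WSum

/-- The identity `w₁(2y) + w₂(2y) + w₃(2y) = -(1/2) ℘''(y)/℘'(y)`. -/
theorem w_sum_eq_wp_log_deriv (τ : ℂ) (hτ : 0 < τ.im) (y : ℂ)
    (hy : jTheta 1 1 (2 * y) τ ≠ 0) (hy' : deriv (wp τ) y ≠ 0) :
    w1 τ (2 * y) + w2 τ (2 * y) + w3 τ (2 * y) =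
      - (1 / 2) * (deriv (deriv (wp τ)) y / deriv (wp τ) y) := by
  exact WSum.main hτ y hy hy'
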